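/- Let φ be a piecewise smooth function on an open subset Ω of an integral ℝ-affine polyhedral set P in N_ℝ, and let Ω̃ be any open subset of N_ℝ with Ω̃ ∩ P = Ω. Then there exists a piecewise smooth function on Ω̃ which restricts to φ on Ω. -/

import Mathlib

open scoped BigOperators

noncomputable section

namespace NonArchDelta

/-- Points of `N_ℝ ≅ ℝ^r`, the real vector space associated to the lattice `N = ℤ^r`. -/
abbrev Pt (r : ℕ) := Fin r → ℝ

variable {r : ℕ}

/-- An integral ℝ-affine polyhedron in `ℝ^r`: an intersection of finitely many
half-spaces with integral normal vectors and real constants. -/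
def IsIntegralPolyhedron (P : Set (Pt r)) : Prop :=
  ∃ (m : ℕ) (u : Fin m → Fin r → ℤ) (c : Fin m → ℝ),
    P = { x | ∀ i, c i ≤ ∑ j, (u i j : ℝ) * x j }

/-- An integral ℝ-affine polyhedral set: a finite union of integral ℝ-affine polyhedra. -/
def IsPolyhedralSet (P : Set (Pt r)) : Prop :=
  ∃ S : Set (Set (Pt r)), S.Finite ∧ (∀ σ ∈ S, IsIntegralPolyhedron σ) ∧ ⋃₀ S = P

/-- `f` is a piecewise smooth function on the subset `Ω` of the integral ℝ-affine polyhedral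
set `P` in `ℝ^r`:  there is an integral ℝ-affine polyhedral decomposition of `P` (the
polyhedra of a polyhedral complex with support `P`) such that on each piece `σ` the
restriction of `f` to `σ ∩ Ω` extends to a smooth function on a neighbourhood of
`σ ∩ Ω`. -/
def IsPiecewiseSmoothOn (P Ω : Set (Pt r)) (f : Pt r → ℝ) : Prop :=
  ∃ S : Set (Set (Pt r)), S.Finite ∧ (∀ σ ∈ S, IsIntegralPolyhedron σ) ∧ ⋃₀ S = P ∧
    ∀ σ ∈ S, ∃ (U : Set (Pt r)) (g : Pt r → ℝ), IsOpen U ∧ σ ∩ Ω ⊆ U ∧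
      ContDiffOn ℝ (⊤ : ℕ∞) g U ∧ ∀ x ∈ σ ∩ Ω, f x = g x

/-- Rational affine functions. -/
def RatAff (f : Pt r → ℝ) : Prop :=
  ∃ (q : Fin r → ℚ) (b : ℝ), ∀ x, f x = ∑ j, (q j : ℝ) * x j + b

lemma RatAff.add {f g : Pt r → ℝ} (hf : RatAff f) (hg : RatAff g) :
    RatAff (fun x => f x + g x) := by
  obtain ⟨q, b, hq⟩ := hf
  obtain ⟨q', b', hq'⟩ := hg
  refine ⟨q + q', b + b', fun x => ?_⟩
  simp only [hq, hq', Pi.add_apply, Rat.cast_add, add_mul, Finset.sum_add_distrib]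
  ring

lemma RatAff.smul {f : Pt r → ℝ} (hf : RatAff f) (c : ℚ) :
    RatAff (fun x => (c : ℝ) * f x) := by
  obtain ⟨q, b, hq⟩ := hf
  refine ⟨fun j => c * q j, c * b, fun x => ?_⟩
  simp only [hq, Rat.cast_mul, mul_add, Finset.mul_sum, mul_assoc]

lemma RatAff.const (c : ℝ) : RatAff (fun _ : Pt r => c) :=
  ⟨0, c, fun x => by simp⟩

lemma RatAff.coord (k : Fin r) : RatAff (fun x : Pt r => x k) :=
  ⟨Pi.single k 1, 0, fun x => by
    rw [Finset.sum_eq_single k]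
    · simp
    · intro j _ hj; simp [hj]
    · simp⟩

lemma RatAff.sum {ι : Type*} (s : Finset ι) {f : ι → Pt r → ℝ} (hf : ∀ i, RatAff (f i)) :
    RatAff (fun x => ∑ i ∈ s, f i x) := by
  classical
  induction s using Finset.induction_on with
  | empty => simpa using RatAff.const 0
  | insert a s ha ih => simpa [Finset.sum_insert ha] using (hf a).add ih

lemma RatAff.comp {f : Pt r → ℝ} (hf : RatAff f) {ρ : Pt r → Pt r}
    (hρ : ∀ k, RatAff (fun x => ρ x k)) : RatAff (fun x => f (ρ x)) := by
  obtain ⟨q, b, hq⟩ := hf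
  simp only [hq]
  exact (RatAff.sum _ fun j => (hρ j).smul (q j)).add (RatAff.const b)

lemma RatAff.contDiff {f : Pt r → ℝ} (hf : RatAff f) : ContDiff ℝ (⊤ : ℕ∞) f := by
  obtain ⟨q, b, hq⟩ := hf
  have : f = fun x => ∑ j, (q j : ℝ) * x j + b := funext hq
  rw [this]
  fun_prop

lemma RatAff.continuous {f : Pt r → ℝ} (hf : RatAff f) : Continuous f :=
  hf.contDiff.continuous

lemma poly_iff {P : Set (Pt r)} : IsIntegralPolyhedron P ↔
    ∃ (m : ℕ) (f : Fin m → Pt r → ℝ), (∀ i, RatAff (f i)) ∧ P = {x | ∀ i, 0 ≤ f i x} := by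
  constructor
  · rintro ⟨m, u, c, rfl⟩
    refine ⟨m, fun i x => ∑ j, (u i j : ℝ) * x j + (- c i), fun i => ?_, ?_⟩
    · exact ⟨fun j => u i j, - c i, fun x => by simp⟩
    · ext x; simp
  · rintro ⟨m, f, hf, rfl⟩
    choose q b hq using hf
    have key : ∀ i, ∃ (D : ℕ) (u : Fin r → ℤ), 0 < D ∧ ∀ j, (u j : ℝ) = D * (q i j : ℝ) := by
      intro i
      refine ⟨∏ j, (q i j).den, fun j => (∏ k ∈ Finset.univ.erase j, (q i k).den) * (q i j).num,
        Finset.prod_pos fun j _ => (q i j).den_pos, fun j => ?_⟩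
      rw [← Finset.mul_prod_erase _ _ (Finset.mem_univ j)]
      have : ((q i j).num : ℝ) = (q i j).den * (q i j : ℝ) := by
        have := Rat.den_mul_eq_num (q i j)
        exact_mod_cast this.symm
      push_cast
      rw [this]; ring
    choose D u hD hu using key
    refine ⟨m, u, fun i => - (D i * b i), ?_⟩
    ext x
    simp only [Set.mem_ofPred_eq]
    refine forall_congr' fun i => ?_
    have : ∑ j, (u i j : ℝ) * x j = D i * ∑ j, (q i j : ℝ) * x j := by
      rw [Finset.mul_sum]
      exact Finset.sum_congr rfl fun j _ => by rw [hu]; ring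
    rw [this, hq]
    have hd : (0 : ℝ) < D i := by exact_mod_cast hD i
    rw [show -((D i : ℝ) * b i) = D i * (- b i) by ring, mul_le_mul_iff_right₀ hd]
    constructor <;> intro h <;> linarith

lemma poly_of {ι : Type*} [Finite ι] {f : ι → Pt r → ℝ} (hf : ∀ i, RatAff (f i)) :
    IsIntegralPolyhedron {x | ∀ i, 0 ≤ f i x} := by
  obtain ⟨n, ⟨e⟩⟩ := Finite.exists_equiv_fin ι
  refine poly_iff.2 ⟨n, fun i => f (e.symm i), fun i => hf _, ?_⟩
  ext x
  simp only [Set.mem_ofPred_eq]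
  constructor
  · intro h i; exact h _
  · intro h i; simpa using h (e i)

lemma poly_inter {P Q : Set (Pt r)} (hP : IsIntegralPolyhedron P) (hQ : IsIntegralPolyhedron Q) :
    IsIntegralPolyhedron (P ∩ Q) := by
  obtain ⟨m, f, hf, rfl⟩ := poly_iff.1 hP
  obtain ⟨n, g, hg, rfl⟩ := poly_iff.1 hQ
  have := poly_of (f := Sum.elim f g) (by rintro (i | i); exacts [hf i, hg i])
  convert this using 1
  ext x; simp

lemma poly_preimage {P : Set (Pt r)} (hP : IsIntegralPolyhedron P) {ρ : Pt r → Pt r}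
    (hρ : ∀ k, RatAff (fun x => ρ x k)) : IsIntegralPolyhedron (ρ ⁻¹' P) := by
  obtain ⟨m, f, hf, rfl⟩ := poly_iff.1 hP
  exact poly_of fun i => (hf i).comp hρ

lemma poly_half {f : Pt r → ℝ} (hf : RatAff f) : IsIntegralPolyhedron {x | 0 ≤ f x} := by
  have := poly_of (ι := Unit) (fun _ => hf)
  simpa using this

lemma poly_univ : IsIntegralPolyhedron (Set.univ : Set (Pt r)) := by
  have := poly_half (RatAff.const (r := r) 0)
  simpa using this

lemma mkPS {P Ω : Set (Pt r)} {f : Pt r → ℝ} {ι : Type*} [Finite ι] (σ : ι → Set (Pt r))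
    (h1 : ∀ i, IsIntegralPolyhedron (σ i)) (h2 : ∀ x, x ∈ P ↔ ∃ i, x ∈ σ i)
    (h3 : ∀ i, ∃ (U : Set (Pt r)) (g : Pt r → ℝ), IsOpen U ∧ σ i ∩ Ω ⊆ U ∧
      ContDiffOn ℝ (⊤ : ℕ∞) g U ∧ ∀ x ∈ σ i ∩ Ω, f x = g x) :
    IsPiecewiseSmoothOn P Ω f := by
  refine ⟨Set.range σ, Set.finite_range σ, ?_, ?_, ?_⟩
  · rintro _ ⟨i, rfl⟩; exact h1 i
  · ext x; simp [h2]
  · rintro _ ⟨i, rfl⟩; exact h3 i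

lemma elimPS {P Ω : Set (Pt r)} {f : Pt r → ℝ} (h : IsPiecewiseSmoothOn P Ω f) :
    ∃ (n : ℕ) (σ : Fin n → Set (Pt r)) (U : Fin n → Set (Pt r)) (g : Fin n → Pt r → ℝ),
    (∀ i, IsIntegralPolyhedron (σ i)) ∧ (∀ x, x ∈ P ↔ ∃ i, x ∈ σ i) ∧
    (∀ i, IsOpen (U i)) ∧ (∀ i, σ i ∩ Ω ⊆ U i) ∧ (∀ i, ContDiffOn ℝ (⊤ : ℕ∞) (g i) (U i)) ∧
    ∀ i, ∀ x ∈ σ i ∩ Ω, f x = g i x := by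
  obtain ⟨S, hS, h1, rfl, h3⟩ := h
  have := hS.to_subtype
  obtain ⟨n, ⟨e⟩⟩ := Finite.exists_equiv_fin S
  choose! U g hU hs hg hf using h3
  refine ⟨n, fun i => (e.symm i : Set (Pt r)), fun i => U (e.symm i), fun i => g (e.symm i),
    fun i => h1 _ (e.symm i).2, fun x => ?_, fun i => hU _ (e.symm i).2,
    fun i => hs _ (e.symm i).2, fun i => hg _ (e.symm i).2, fun i => hf _ (e.symm i).2⟩
  constructor
  · rintro ⟨s, hs, hx⟩; exact ⟨e ⟨s, hs⟩, by simpa using hx⟩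
  · rintro ⟨i, hx⟩; exact ⟨_, (e.symm i).2, hx⟩

lemma PS_add {P Ω : Set (Pt r)} {f g : Pt r → ℝ} (hf : IsPiecewiseSmoothOn P Ω f)
    (hg : IsPiecewiseSmoothOn P Ω g) : IsPiecewiseSmoothOn P Ω (fun x => f x + g x) := by
  obtain ⟨n, σ, U, u, h1, h2, h3, h4, h5, h6⟩ := elimPS hf
  obtain ⟨n', σ', U', u', h1', h2', h3', h4', h5', h6'⟩ := elimPS hg
  refine mkPS (ι := Fin n × Fin n') (fun i => σ i.1 ∩ σ' i.2) (fun i => poly_inter (h1 _) (h1' _))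
    (fun x => ?_) (fun i => ⟨U i.1 ∩ U' i.2, fun x => u i.1 x + u' i.2 x,
      (h3 _).inter (h3' _), ?_, ?_, ?_⟩)
  · constructor
    · intro hx
      obtain ⟨i, hi⟩ := (h2 x).1 hx
      obtain ⟨j, hj⟩ := (h2' x).1 hx
      exact ⟨(i, j), hi, hj⟩
    · rintro ⟨i, hi⟩; exact (h2 x).2 ⟨i.1, hi.1⟩
  · rintro x ⟨⟨a, b⟩, c⟩; exact ⟨h4 _ ⟨a, c⟩, h4' _ ⟨b, c⟩⟩
  · exact ((h5 _).mono Set.inter_subset_left).add ((h5' _).mono Set.inter_subset_right)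
  · rintro x ⟨⟨a, b⟩, c⟩
    simp only [h6 _ x ⟨a, c⟩, h6' _ x ⟨b, c⟩]

lemma PS_zero (V : Set (Pt r)) : IsPiecewiseSmoothOn Set.univ V (fun _ => 0) :=
  mkPS (ι := Unit) (fun _ => Set.univ) (fun _ => poly_univ) (fun x => by simp)
    (fun _ => ⟨Set.univ, fun _ => 0, isOpen_univ, by simp, contDiffOn_const, by simp⟩)

lemma sep_open {W A B : Set (Pt r)} (hA : W ∩ closure A ⊆ A) (hB : W ∩ closure B ⊆ B)
    (hAW : A ⊆ W) (hBW : B ⊆ W) (hd : Disjoint A B) :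
    ∃ V V' : Set (Pt r), IsOpen V ∧ IsOpen V' ∧ A ⊆ V ∧ B ⊆ V' ∧ Disjoint V V' := by
  have h1 : Disjoint (closure A) B := by
    rw [Set.disjoint_left] at hd ⊢
    intro x hx hxB; exact hd (hA ⟨hBW hxB, hx⟩) hxB
  have h2 : Disjoint A (closure B) := by
    rw [Set.disjoint_left] at hd ⊢
    intro x hx hxB; exact hd hx (hB ⟨hAW hx, hxB⟩)
  exact separatedNhds_iff_disjoint.2 (CompletelyNormalSpace.completely_normal h1 h2)

lemma cutoff {U₁ U₂ : Set (Pt r)} (h₁ : IsOpen U₁) (h₂ : IsOpen U₂) :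
    ∃ (V₁ V₂ : Set (Pt r)) (χ : Pt r → ℝ), IsOpen V₁ ∧ IsOpen V₂ ∧ U₁ \ U₂ ⊆ V₁ ∧ U₂ \ U₁ ⊆ V₂ ∧
      ContDiffOn ℝ (⊤ : ℕ∞) χ (U₁ ∪ U₂) ∧ (∀ x ∈ U₁ ∪ U₂, 0 ≤ χ x ∧ χ x ≤ 1) ∧
      (∀ x ∈ V₁ ∩ (U₁ ∪ U₂), χ x = 1) ∧ ∀ x ∈ V₂ ∩ (U₁ ∪ U₂), χ x = 0 := by
  have hA : (U₁ ∪ U₂) ∩ closure (U₁ \ U₂) ⊆ U₁ \ U₂ := by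
    rintro x ⟨hx, hc⟩
    have : x ∉ U₂ := fun h => by
      have := mem_closure_iff.1 hc U₂ h₂ h
      obtain ⟨y, hy, hy'⟩ := this
      exact hy'.2 hy
    exact ⟨hx.resolve_right this, this⟩
  have hB : (U₁ ∪ U₂) ∩ closure (U₂ \ U₁) ⊆ U₂ \ U₁ := by
    rintro x ⟨hx, hc⟩
    have : x ∉ U₁ := fun h => by
      have := mem_closure_iff.1 hc U₁ h₁ h
      obtain ⟨y, hy, hy'⟩ := this
      exact hy'.2 hy
    exact ⟨hx.resolve_left this, this⟩
  have hAW : U₁ \ U₂ ⊆ U₁ ∪ U₂ := fun x hx => Or.inl hx.1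
  have hBW : U₂ \ U₁ ⊆ U₁ ∪ U₂ := fun x hx => Or.inr hx.1
  obtain ⟨V, V', oV, oV', hV, hV', hd⟩ := sep_open hA hB hAW hBW
    (Set.disjoint_left.2 fun x hx hx' => hx.2 hx'.1)
  have hd' : Disjoint (closure V) V' := hd.closure_left oV'
  obtain ⟨W₁, W₂, oW₁, oW₂, hW₁, hW₂, hd2⟩ := sep_open (W := U₁ ∪ U₂)
    (A := (U₁ ∪ U₂) ∩ closure V) (B := U₂ \ U₁)
    (fun x hx => ⟨hx.1, by
      have := closure_mono (Set.inter_subset_right : (U₁ ∪ U₂) ∩ closure V ⊆ closure V) hx.2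
      simpa using this⟩) hB Set.inter_subset_left hBW
    (Set.disjoint_left.2 fun x hx hx' => Set.disjoint_left.1 hd' hx.2 (hV' hx'))
  have hd3 : Disjoint W₁ (closure W₂) := hd2.closure_right oW₁
  obtain ⟨f, hfs, hf, hfr⟩ := (isClosed_closure (s := W₂)).isOpen_compl.exists_contDiff_support_eq (n := ⊤)
  obtain ⟨g, hgs, hg, hgr⟩ := (isClosed_closure (s := V)).isOpen_compl.exists_contDiff_support_eq (n := ⊤)
  have hf0 : ∀ x, 0 ≤ f x := fun x => (hfr ⟨x, rfl⟩).1
  have hg0 : ∀ x, 0 ≤ g x := fun x => (hgr ⟨x, rfl⟩).1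
  have hfz : ∀ x, f x = 0 ↔ x ∈ closure W₂ := fun x => by
    have : x ∈ Function.support f ↔ x ∈ (closure W₂)ᶜ := by rw [hfs]
    simpa [Function.mem_support, not_iff_not] using this
  have hgz : ∀ x, g x = 0 ↔ x ∈ closure V := fun x => by
    have : x ∈ Function.support g ↔ x ∈ (closure V)ᶜ := by rw [hgs]
    simpa [Function.mem_support, not_iff_not] using this
  have hpos : ∀ x ∈ U₁ ∪ U₂, 0 < f x + g x := by
    intro x hx
    rcases (hf0 x).lt_or_eq with h | h
    · exact add_pos_of_pos_of_nonneg h (hg0 x)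
    · refine add_pos_of_nonneg_of_pos (hf0 x) (lt_of_le_of_ne (hg0 x) fun h' => ?_)
      exact Set.disjoint_left.1 hd3 (hW₁ ⟨hx, (hgz x).1 h'.symm⟩) ((hfz x).1 h.symm)
  refine ⟨V, W₂, fun x => f x / (f x + g x), oV, oW₂, hV, hW₂, ?_, ?_, ?_, ?_⟩
  · exact hf.contDiffOn.div (hf.add hg).contDiffOn fun x hx => (hpos x hx).ne'
  · intro x hx
    exact ⟨div_nonneg (hf0 x) (hpos x hx).le, (div_le_one (hpos x hx)).2 (by linarith [hg0 x])⟩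
  · rintro x ⟨hx, hx'⟩
    have : g x = 0 := (hgz x).2 (subset_closure hx)
    have h := (hpos x hx').ne'
    rw [this, add_zero] at h
    simp [this, h]
  · rintro x ⟨hx, hx'⟩
    simp [(hfz x).2 (subset_closure hx)]

lemma glue2 {U₁ U₂ : Set (Pt r)} (h₁ : IsOpen U₁) (h₂ : IsOpen U₂) (t : Pt r → Set ℝ)
    (ht : ∀ x, Convex ℝ (t x)) {f₁ f₂ : Pt r → ℝ}
    (hf₁ : IsPiecewiseSmoothOn Set.univ U₁ f₁) (hf₂ : IsPiecewiseSmoothOn Set.univ U₂ f₂)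
    (ht₁ : ∀ x ∈ U₁, f₁ x ∈ t x) (ht₂ : ∀ x ∈ U₂, f₂ x ∈ t x) :
    ∃ f, IsPiecewiseSmoothOn Set.univ (U₁ ∪ U₂) f ∧ ∀ x ∈ U₁ ∪ U₂, f x ∈ t x := by
  obtain ⟨V₁, V₂, χ, oV₁, oV₂, hV₁, hV₂, hχ, hχ01, hχ1, hχ0⟩ := cutoff h₁ h₂
  obtain ⟨n, σ, U, u, a1, a2, a3, a4, a5, a6⟩ := elimPS hf₁
  obtain ⟨n', σ', U', u', b1, b2, b3, b4, b5, b6⟩ := elimPS hf₂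
  refine ⟨fun x => χ x * f₁ x + (1 - χ x) * f₂ x, ?_, ?_⟩
  · refine mkPS (ι := Fin n × Fin n') (fun i => σ i.1 ∩ σ' i.2)
      (fun i => poly_inter (a1 _) (b1 _)) (fun x => ?_)
      (fun i => ⟨(U₁ ∪ U₂) ∩ (U i.1 ∩ U' i.2 ∪ U i.1 ∩ V₁ ∪ U' i.2 ∩ V₂),
        fun x => χ x * u i.1 x + (1 - χ x) * u' i.2 x, ?_, ?_, ?_, ?_⟩)
    · obtain ⟨i, hi⟩ := (a2 x).1 trivial
      obtain ⟨j, hj⟩ := (b2 x).1 trivial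
      simp only [Set.mem_univ, true_iff]
      exact ⟨(i, j), hi, hj⟩
    · exact (h₁.union h₂).inter ((((a3 _).inter (b3 _)).union ((a3 _).inter oV₁)).union
        ((b3 _).inter oV₂))
    · rintro x ⟨⟨p, q⟩, hx⟩
      refine ⟨hx, ?_⟩
      by_cases k1 : x ∈ U₁ <;> by_cases k2 : x ∈ U₂
      · exact Or.inl (Or.inl ⟨a4 _ ⟨p, k1⟩, b4 _ ⟨q, k2⟩⟩)
      · exact Or.inl (Or.inr ⟨a4 _ ⟨p, k1⟩, hV₁ ⟨k1, k2⟩⟩)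
      · exact Or.inr ⟨b4 _ ⟨q, k2⟩, hV₂ ⟨k2, k1⟩⟩
      · exact absurd hx (by simp [k1, k2])
    · rintro x ⟨hx, hx'⟩
      apply ContDiffAt.contDiffWithinAt
      have oU := h₁.union h₂
      have cχ : ContDiffAt ℝ (⊤ : ℕ∞) χ x := hχ.contDiffAt (oU.mem_nhds hx)
      rcases hx' with (⟨k1, k2⟩ | ⟨k1, k2⟩) | ⟨k1, k2⟩
      · exact (cχ.mul ((a5 _).contDiffAt ((a3 _).mem_nhds k1))).add
          ((contDiffAt_const.sub cχ).mul ((b5 _).contDiffAt ((b3 _).mem_nhds k2)))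
      · refine ((a5 _).contDiffAt ((a3 _).mem_nhds k1)).congr_of_eventuallyEq ?_
        filter_upwards [(oV₁.inter oU).mem_nhds ⟨k2, hx⟩] with y hy
        simp [hχ1 y hy]
      · refine ((b5 _).contDiffAt ((b3 _).mem_nhds k1)).congr_of_eventuallyEq ?_
        filter_upwards [(oV₂.inter oU).mem_nhds ⟨k2, hx⟩] with y hy
        simp [hχ0 y hy]
    · rintro x ⟨⟨p, q⟩, hx⟩
      by_cases k1 : x ∈ U₁ <;> by_cases k2 : x ∈ U₂
      · simp only [a6 _ x ⟨p, k1⟩, b6 _ x ⟨q, k2⟩]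
      · simp only [a6 _ x ⟨p, k1⟩, hχ1 x ⟨hV₁ ⟨k1, k2⟩, hx⟩]; simp
      · simp only [b6 _ x ⟨q, k2⟩, hχ0 x ⟨hV₂ ⟨k2, k1⟩, hx⟩]; simp
      · exact absurd hx (by simp [k1, k2])
  · intro x hx
    by_cases k1 : x ∈ U₁ <;> by_cases k2 : x ∈ U₂
    · exact ht x (ht₁ x k1) (ht₂ x k2) (hχ01 x hx).1 (by linarith [(hχ01 x hx).2]) (by ring)
    · simpa [hχ1 x ⟨hV₁ ⟨k1, k2⟩, hx⟩] using ht₁ x k1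
    · simpa [hχ0 x ⟨hV₂ ⟨k2, k1⟩, hx⟩] using ht₂ x k2
    · exact absurd hx (by simp [k1, k2])

lemma glue {ι : Type*} (s : Finset ι) (U : ι → Set (Pt r)) (hU : ∀ i, IsOpen (U i))
    (t : Pt r → Set ℝ) (ht : ∀ x, Convex ℝ (t x)) (f : ι → Pt r → ℝ)
    (hf : ∀ i, IsPiecewiseSmoothOn Set.univ (U i) (f i)) (hft : ∀ i, ∀ x ∈ U i, f i x ∈ t x) :
    ∃ F, IsPiecewiseSmoothOn Set.univ (⋃ i ∈ s, U i) F ∧ ∀ x ∈ ⋃ i ∈ s, U i, F x ∈ t x := by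
  classical
  induction s using Finset.induction_on with
  | empty => exact ⟨fun _ => 0, PS_zero _, by simp⟩
  | insert a s ha ih =>
    obtain ⟨F, hF, hFt⟩ := ih
    rw [Finset.set_biUnion_insert]
    exact glue2 (hU a) (isOpen_biUnion fun i _ => hU i) t ht (hf a) hF (hft a) hFt

lemma gen_inv {ι : Type*} [Fintype ι] [DecidableEq ι] (M : Matrix ι (Fin r) ℚ) :
    ∃ B : Matrix (Fin r) ι ℚ, M * B * M = M := by
  let f := Matrix.toLin' M
  obtain ⟨g, hg⟩ := f.rangeRestrict.exists_rightInverse_of_surjective f.range_rangeRestrict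
  obtain ⟨G, hG⟩ := g.exists_extend
  refine ⟨LinearMap.toMatrix' G, ?_⟩
  apply Matrix.toLin'.injective
  rw [Matrix.toLin'_mul, Matrix.toLin'_mul, Matrix.toLin'_toMatrix']
  refine LinearMap.ext fun w => ?_
  have h1 : G (f w) = g (f.rangeRestrict w) := by
    rw [← hG]; rfl
  have h2 := congrArg Subtype.val (LinearMap.congr_fun hg (f.rangeRestrict w))
  change f (G (f w)) = f w
  rw [h1]; exact h2

/-- Linear part of a rational affine function. -/
def lin (q : Fin r → ℚ) : Pt r →ₗ[ℝ] ℝ := ∑ j, (q j : ℝ) • LinearMap.proj j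

lemma lin_apply (q : Fin r → ℚ) (v : Pt r) : lin q v = ∑ j, (q j : ℝ) * v j := by
  simp [lin]

lemma retr {ι κ : Type*} [Finite ι] [Finite κ] (a : ι → Pt r → ℝ) (l : κ → Pt r → ℝ)
    (ha : ∀ i, RatAff (a i)) (hl : ∀ j, RatAff (l j)) (p x₀ : Pt r)
    (hp : ∀ i, a i p = 0) (hx₀ : ∀ i, a i x₀ = 0) (hpl : ∀ j, 0 < l j p) :
    ∃ ρ : Pt r → Pt r, Continuous ρ ∧ (∀ y, (∀ i, a i y = 0) → ρ y = y) ∧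
      (∀ y i, a i (ρ y) = 0) ∧ (∀ j y, l j x₀ ≤ 0 → l j y ≤ 0 → l j (ρ y) ≤ 0) ∧
      ∃ (R : (ι → Bool) → Set (Pt r)) (ρ' : (ι → Bool) → Pt r → Pt r),
        (∀ e, IsIntegralPolyhedron (R e)) ∧ (∀ y, ∃ e, y ∈ R e) ∧
        (∀ e k, RatAff (fun y => ρ' e y k)) ∧ ∀ e, ∀ y ∈ R e, ρ y = ρ' e y := by
  classical
  have := Fintype.ofFinite ι
  have := Fintype.ofFinite κ
  have hac := fun i => (ha i).continuous
  have ha' := ha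
  choose q b hq using ha
  choose q' b' hq' using hl
  have hA : ∀ i x v, a i (x + v) = a i x + lin (q i) v := by
    intro i x v
    simp only [hq, lin_apply, Pi.add_apply, mul_add, Finset.sum_add_distrib]; ring
  have hL : ∀ i x v, l i (x + v) = l i x + lin (q' i) v := by
    intro i x v
    simp only [hq', lin_apply, Pi.add_apply, mul_add, Finset.sum_add_distrib]; ring
  obtain ⟨B, hB⟩ := gen_inv (Matrix.of q)
  let Bv : ι → Pt r := fun i k => (B k i : ℝ)
  have hid : ∀ v k, lin (q k) (∑ i, lin (q i) v • Bv i) = lin (q k) v := by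
    intro v k
    have h1 : ∀ j, ∑ i, lin (q k) (Bv i) * (q i j : ℝ) = q k j := by
      intro j
      have := congrFun (congrFun hB k) j
      rw [Matrix.mul_apply] at this
      simp only [Matrix.mul_apply, Matrix.of_apply] at this
      rw [← this]
      push_cast
      simp only [lin_apply, Bv]
    rw [map_sum]
    simp only [map_smul, smul_eq_mul]
    calc ∑ i, lin (q i) v * lin (q k) (Bv i)
        = ∑ i, ∑ j, (lin (q k) (Bv i) * (q i j : ℝ)) * v j := by
          refine Finset.sum_congr rfl fun i _ => ?_
          rw [lin_apply (q i) v, Finset.sum_mul]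
          exact Finset.sum_congr rfl fun j _ => by ring
      _ = ∑ j, (∑ i, lin (q k) (Bv i) * (q i j : ℝ)) * v j := by
          rw [Finset.sum_comm]
          simp only [Finset.sum_mul]
      _ = lin (q k) v := by rw [lin_apply]; simp only [h1]
  have hap : ∀ i y, a i y = lin (q i) (y - p) := by
    intro i y
    have := hA i p (y - p)
    rw [hp, zero_add] at this
    rw [← this]; simp
  -- the rational direction
  have hw : ∃ w : Fin r → ℚ, (∀ i, lin (q i) (fun k => (w k : ℝ)) = 0) ∧
      ∀ j, l j x₀ ≤ 0 → 0 < lin (q' j) (fun k => (w k : ℝ)) := by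
    let O : Set (Pt r) := {v | ∀ j, l j x₀ ≤ 0 → 0 < lin (q' j) (v - ∑ i, lin (q i) v • Bv i)}
    have hc : ∀ j, Continuous fun v : Pt r => lin (q' j) (v - ∑ i, lin (q i) v • Bv i) := by
      intro j
      have : ∀ q : Fin r → ℚ, Continuous (lin q) := fun q => LinearMap.continuous_of_finiteDimensional _
      have h1 := this (q' j)
      have h2 := fun i => this (q i)
      fun_prop
    have hO : IsOpen O := by
      have : O = ⋂ j, {v | l j x₀ ≤ 0 → 0 < lin (q' j) (v - ∑ i, lin (q i) v • Bv i)} := by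
        ext v; simp [O]
      rw [this]
      refine isOpen_iInter_of_finite fun j => ?_
      by_cases h : l j x₀ ≤ 0
      · simp only [h, forall_const]
        exact isOpen_lt continuous_const (hc j)
      · simp [h]
    have hne : (p - x₀) ∈ O := by
      intro j hj
      have : ∀ i, lin (q i) (p - x₀) = 0 := by
        intro i
        have := hap i x₀
        rw [hx₀, ← neg_sub, map_neg] at this
        linarith
      simp only [this, zero_smul, Finset.sum_const_zero, sub_zero]
      have h := hL j x₀ (p - x₀)
      rw [add_sub_cancel] at h
      linarith [hpl j]
    have hdense : DenseRange (fun s : Fin r → ℚ => fun k => (s k : ℝ)) :=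
      DenseRange.piMap fun _ => Rat.denseRange_cast
    obtain ⟨s, hs⟩ := hdense.exists_mem_open hO ⟨_, hne⟩
    have e : (fun k => (((fun k => s k - ∑ i, (∑ j, q i j * s j) * B k i : Fin r → ℚ) k : ℚ) : ℝ))
        = (fun k => (s k : ℝ)) - ∑ i, lin (q i) (fun k => (s k : ℝ)) • Bv i := by
      funext k
      simp [lin_apply, Bv]
    refine ⟨fun k => s k - ∑ i, (∑ j, q i j * s j) * B k i, ?_, ?_⟩
    · intro i
      rw [e, map_sub, hid, sub_self]
    · intro j hj
      rw [e]; exact hs j hj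
  obtain ⟨w, hw1, hw2⟩ := hw
  let wv : Pt r := fun k => (w k : ℝ)
  have hK : ∀ j, ∃ n : ℕ, l j x₀ ≤ 0 → ∑ i, |lin (q' j) (Bv i)| ≤ n * lin (q' j) wv := by
    intro j
    by_cases h : l j x₀ ≤ 0
    · obtain ⟨n, hn⟩ := exists_nat_ge ((∑ i, |lin (q' j) (Bv i)|) / lin (q' j) wv)
      exact ⟨n, fun _ => (div_le_iff₀ (hw2 j h)).1 hn⟩
    · exact ⟨0, fun h' => absurd h' h⟩
  choose n hn using hK
  let K : ℕ := ∑ j, n j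
  have hKn : ∀ j, l j x₀ ≤ 0 → ∑ i, |lin (q' j) (Bv i)| ≤ K * lin (q' j) wv := by
    intro j hj
    refine (hn j hj).trans (mul_le_mul_of_nonneg_right ?_ (hw2 j hj).le)
    exact_mod_cast Finset.single_le_sum (f := n) (fun _ _ => Nat.zero_le _) (Finset.mem_univ j)
  let sg : Bool → ℚ := fun t => if t then 1 else -1
  refine ⟨fun y => y + (- (∑ i, a i y • Bv i) + (-(K * ∑ i, |a i y|)) • wv), ?_, ?_, ?_, ?_,
    fun e => {y | ∀ i, 0 ≤ (sg (e i) : ℝ) * a i y},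
    fun e y => y + (- (∑ i, a i y • Bv i) + (-(K * ∑ i, (sg (e i) : ℝ) * a i y)) • wv),
    ?_, ?_, ?_, ?_⟩
  · fun_prop
  · intro y hy; simp [hy]
  · intro y i
    dsimp only
    rw [hA, map_add, map_neg, map_smul]
    simp only [hap _ y]
    rw [hid]
    have := hw1 i
    simp only [wv, this]; simp
  · intro j y hj hy
    dsimp only
    rw [hL, map_add, map_neg, map_smul, map_sum]
    simp only [map_smul, smul_eq_mul]
    have h1 : - ∑ i, a i y * lin (q' j) (Bv i) ≤ (∑ i, |a i y|) * ∑ i, |lin (q' j) (Bv i)| := by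
      rw [Finset.sum_mul, ← Finset.sum_neg_distrib]
      refine Finset.sum_le_sum fun i _ => ?_
      calc -(a i y * lin (q' j) (Bv i)) ≤ |a i y| * |lin (q' j) (Bv i)| := by
            rw [← abs_mul]; exact neg_le_abs _
        _ ≤ _ := mul_le_mul_of_nonneg_left
            (Finset.single_le_sum (f := fun i => |lin (q' j) (Bv i)|)
              (fun _ _ => abs_nonneg _) (Finset.mem_univ i)) (abs_nonneg _)
    have h2 := mul_le_mul_of_nonneg_left (hKn j hj)
      (Finset.sum_nonneg fun i _ => abs_nonneg (a i y) : 0 ≤ ∑ i, |a i y|)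
    nlinarith
  · intro e
    exact poly_of fun i => (ha' i).smul _
  · intro y
    refine ⟨fun i => decide (0 ≤ a i y), fun i => ?_⟩
    by_cases h : 0 ≤ a i y
    · simp [sg, h]
    · simp [sg, h]; linarith
  · intro e k
    have h1 : RatAff fun y => ∑ i, (B k i : ℝ) * a i y := RatAff.sum _ fun i => (ha' i).smul _
    have h2 : RatAff fun y => ∑ i, (sg (e i) : ℝ) * a i y := RatAff.sum _ fun i => (ha' i).smul _
    have h3 := (RatAff.coord k).add ((h1.smul (-1)).add (h2.smul (-(K * w k))))
    convert h3 using 2 with y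
    simp only [Pi.add_apply, Pi.neg_apply, Finset.sum_apply, Pi.smul_apply, smul_eq_mul, Bv, wv]
    push_cast
    rw [Finset.sum_congr rfl fun i _ => mul_comm (a i y) (B k i : ℝ)]
    ring
  · intro e y hy
    have : ∀ i, |a i y| = (sg (e i) : ℝ) * a i y := by
      intro i
      have h := hy i
      cases hb : e i
      · simp [sg, hb] at h ⊢; exact h
      · simp [sg, hb] at h ⊢; exact h
    simp only [this]

lemma key {ι κ : Type*} [Finite ι] [Finite κ] (a : ι → Pt r → ℝ) (l : κ → Pt r → ℝ)
    (ha : ∀ i, RatAff (a i)) (hl : ∀ j, RatAff (l j)) (p : Pt r)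
    (hp : ∀ i, a i p = 0) (hpl : ∀ j, 0 < l j p) (C W : Set (Pt r)) (hW : IsOpen W)
    (hC : C = {x | (∀ i, a i x = 0) ∧ ∀ j, 0 ≤ l j x}) (h : Pt r → ℝ)
    (hh : IsPiecewiseSmoothOn C W h) (h0 : ∀ x ∈ C ∩ W, (∃ j, l j x ≤ 0) → h x = 0) :
    ∃ F, IsPiecewiseSmoothOn Set.univ W F ∧ (∀ x ∈ C ∩ W, F x = h x) ∧
      ∀ x ∈ W, (∃ j, l j x ≤ 0) → F x = 0 := by
  classical
  have memC : ∀ x, x ∈ C ↔ (∀ i, a i x = 0) ∧ ∀ j, 0 ≤ l j x := fun x => by rw [hC]; rfl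
  have hCc : IsClosed C := by
    have : C = (⋂ i, {x | a i x = 0}) ∩ ⋂ j, {x | 0 ≤ l j x} := by
      ext x; simp [memC]
    rw [this]
    exact (isClosed_iInter fun i => isClosed_eq (ha i).continuous continuous_const).inter
      (isClosed_iInter fun j => isClosed_le continuous_const (hl j).continuous)
  let t : Pt r → Set ℝ := fun x => {v | (x ∈ C → v = h x) ∧ ((∃ j, l j x ≤ 0) → v = 0)}
  have ht : ∀ x, Convex ℝ (t x) := by
    rintro x u ⟨hu1, hu2⟩ v ⟨hv1, hv2⟩ α β hα hβ hαβ
    refine ⟨fun hx => ?_, fun hx => ?_⟩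
    · rw [hu1 hx, hv1 hx, ← add_smul, hαβ, one_smul]
    · simp [hu2 hx, hv2 hx]
  have loc : ∀ E : Set κ, ∃ (U : Set (Pt r)) (F : Pt r → ℝ), IsOpen U ∧ U ⊆ W ∧
      IsPiecewiseSmoothOn Set.univ U F ∧ (∀ x ∈ U, F x ∈ t x) ∧
      ∀ x ∈ C ∩ W, {j | l j x ≤ 0} = E → x ∈ U := by
    intro E
    by_cases hE : ∃ x₀ ∈ C, {j | l j x₀ ≤ 0} = E
    swap
    · exact ⟨∅, fun _ => 0, isOpen_empty, by simp, PS_zero _, by simp,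
        fun x hx hx' => hE ⟨x, hx.1, hx'⟩⟩
    obtain ⟨x₀, hx₀, rfl⟩ := hE
    obtain ⟨ρ, cρ, ρid, ρa, ρl, R, ρ', hR, hRc, hρ', hρρ'⟩ :=
      retr a l ha hl p x₀ hp ((memC _).1 hx₀).1 hpl
    obtain ⟨n, σ, V, g, s1, s2, s3, s4, s5, s6⟩ := elimPS hh
    have hU : IsOpen ((W ∩ ρ ⁻¹' W) ∩ ⋂ j, {y | 0 < l j x₀ → 0 < l j y}) := by
      refine (hW.inter (hW.preimage cρ)).inter (isOpen_iInter_of_finite fun j => ?_)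
      by_cases hj : 0 < l j x₀
      · simp only [hj, forall_const]
        exact isOpen_lt continuous_const (hl j).continuous
      · simp [hj]
    refine ⟨(W ∩ ρ ⁻¹' W) ∩ ⋂ j, {y | 0 < l j x₀ → 0 < l j y},
      fun y => if ρ y ∈ C then h (ρ y) else 0, hU, fun x hx => hx.1.1, ?_, ?_, ?_⟩
    · have smρ : ∀ e, ContDiff ℝ (⊤ : ℕ∞) (ρ' e) := fun e =>
        contDiff_pi.2 fun k => (hρ' e k).contDiff
      refine mkPS (ι := (ι → Bool) × (Fin n ⊕ κ))
        (fun i => R i.1 ∩ (ρ' i.1) ⁻¹' (Sum.elim σ (fun j => {y | 0 ≤ ((-1 : ℚ) : ℝ) * l j y}) i.2))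
        ?_ ?_ ?_
      · rintro ⟨e, i⟩
        refine poly_inter (hR e) (poly_preimage ?_ (hρ' e))
        rcases i with i | j
        · exact s1 i
        · exact poly_half ((hl j).smul _)
      · intro y
        simp only [Set.mem_univ, true_iff]
        obtain ⟨e, he⟩ := hRc y
        by_cases hy : ∃ j, l j (ρ y) ≤ 0
        · obtain ⟨j, hj⟩ := hy
          refine ⟨(e, Sum.inr j), he, ?_⟩
          rw [hρρ' e y he] at hj
          simpa using hj
        · push Not at hy
          obtain ⟨i, hi⟩ := (s2 (ρ y)).1 ((memC _).2 ⟨ρa y, fun j => (hy j).le⟩)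
          refine ⟨(e, Sum.inl i), he, ?_⟩
          rw [hρρ' e y he] at hi
          exact hi
      · rintro ⟨e, i | j⟩
        · refine ⟨ρ' e ⁻¹' V i, g i ∘ ρ' e, (s3 i).preimage (smρ e).continuous, ?_, ?_, ?_⟩
          · rintro y ⟨⟨hy1, hy2⟩, hy3⟩
            refine s4 i ⟨hy2, ?_⟩
            rw [← hρρ' e y hy1]; exact hy3.1.2
          · exact (s5 i).comp (smρ e).contDiffOn (fun x hx => hx)
          · rintro y ⟨⟨hy1, hy2⟩, hy3⟩
            have hy2' : ρ' e y ∈ σ i := hy2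
            have hm : ρ y ∈ σ i ∩ W := ⟨by rw [hρρ' e y hy1]; exact hy2', hy3.1.2⟩
            dsimp only [Function.comp]
            rw [if_pos ((s2 (ρ y)).2 ⟨i, hm.1⟩), s6 i _ hm, hρρ' e y hy1]
        · refine ⟨Set.univ, fun _ => 0, isOpen_univ, by simp, contDiffOn_const, ?_⟩
          rintro y ⟨⟨hy1, hy2⟩, hy3⟩
          have hj : l j (ρ y) ≤ 0 := by
            rw [hρρ' e y hy1]; simpa using hy2
          dsimp only
          split_ifs with hc
          · exact h0 _ ⟨hc, hy3.1.2⟩ ⟨j, hj⟩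
          · rfl
    · rintro y ⟨⟨hy1, hy2⟩, hy3⟩
      refine ⟨fun hy => ?_, ?_⟩
      · dsimp only
        rw [ρid y ((memC _).1 hy).1, if_pos hy]
      · rintro ⟨j, hj⟩
        have : l j x₀ ≤ 0 := by
          by_contra hcon
          exact absurd (Set.mem_iInter.1 hy3 j (not_le.1 hcon)) (not_lt.2 hj)
        have := ρl j y this hj
        dsimp only
        split_ifs with hc
        · exact h0 _ ⟨hc, hy2⟩ ⟨j, this⟩
        · rfl
    · rintro x ⟨hx1, hx2⟩ he
      refine ⟨⟨hx2, ?_⟩, Set.mem_iInter.2 fun j hj => ?_⟩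
      · change ρ x ∈ W
        rwa [ρid x ((memC _).1 hx1).1]
      · by_contra hcon
        have h1 : j ∈ {j | l j x ≤ 0} := not_lt.1 hcon
        rw [he] at h1
        exact absurd hj (not_lt.2 h1)
  choose U F hU hUW hF hFt hUC using loc
  have := Fintype.ofFinite κ
  obtain ⟨G, hG, hGt⟩ := glue Finset.univ (fun o : Option (Set κ) => o.elim (W \ C) U)
    (by rintro (_ | E); exacts [hW.sdiff hCc, hU E]) t ht
    (fun o => o.elim (fun _ => 0) F)
    (by rintro (_ | E); exacts [PS_zero _, hF E])
    (by
      rintro (_ | E) x hx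
      · exact ⟨fun hx' => absurd hx' hx.2, fun _ => rfl⟩
      · exact hFt E x hx)
  have hWe : (⋃ o ∈ (Finset.univ : Finset (Option (Set κ))), o.elim (W \ C) U) = W := by
    ext x
    simp only [Finset.mem_univ, Set.iUnion_true, Set.mem_iUnion]
    constructor
    · rintro ⟨_ | E, hx⟩
      exacts [hx.1, hUW E hx]
    · intro hx
      by_cases hc : x ∈ C
      · exact ⟨some _, hUC _ x ⟨hc, hx⟩ rfl⟩
      · exact ⟨none, hx, hc⟩
  rw [hWe] at hG hGt
  exact ⟨G, hG, fun x hx => (hGt x hx.2).1 hx.1, fun x hx => (hGt x hx).2⟩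

lemma main_aux {ι : Type*} [Fintype ι] (P W : Set (Pt r)) (φ : Pt r → ℝ) (hW : IsOpen W)
    (ℓ : ι → Pt r → ℝ) (hℓ : ∀ i, RatAff (ℓ i))
    (hP : ∀ p ∈ P, ∃ (U : Set (Pt r)) (g : Pt r → ℝ), IsOpen U ∧ ContDiffOn ℝ (⊤ : ℕ∞) g U ∧
      ∀ x, (∀ i, 0 ≤ ℓ i p → 0 ≤ ℓ i x) → x ∈ P ∧ (x ∈ W → x ∈ U ∧ φ x = g x)) :
    ∃ ψ, IsPiecewiseSmoothOn Set.univ W ψ ∧ ∀ x ∈ W ∩ P, ψ x = φ x := by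
  classical
  let sg : Pt r → ι → SignType := fun x i => SignType.sign (ℓ i x)
  let cnt : (ι → SignType) → ℕ := fun s => (Finset.univ.filter fun i => s i ≠ 0).card
  have main : ∀ A : Finset (ι → SignType), (∀ s ∈ A, ∃ p ∈ P, sg p = s) →
      (∀ s ∈ A, ∀ x ∈ P, (∀ i, sg x i = 0 ∨ sg x i = s i) → sg x ∈ A) →
      ∃ ψ, IsPiecewiseSmoothOn Set.univ W ψ ∧ ∀ x ∈ W ∩ P, sg x ∈ A → ψ x = φ x := by
    intro A
    induction A using Finset.induction_on_max_value cnt with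
    | empty => intro _ _; exact ⟨fun _ => 0, PS_zero _, by simp⟩
    | insert s A hsA hmax ih =>
      intro hA1 hA2
      have hcnt : ∀ (u v : ι → SignType), (∀ i, u i = 0 ∨ u i = v i) → cnt v ≤ cnt u → u = v := by
        intro u v huv hc
        have hsub : (Finset.univ.filter fun i => u i ≠ 0) ⊆ Finset.univ.filter fun i => v i ≠ 0 := by
          intro i hi
          simp only [Finset.mem_filter, Finset.mem_univ, true_and] at hi ⊢
          rw [← (huv i).resolve_left hi]; exact hi
        have heq := Finset.eq_of_subset_of_card_le hsub hc
        funext i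
        rcases huv i with h | h
        · have : i ∉ Finset.univ.filter fun i => v i ≠ 0 := by rw [← heq]; simp [h]
          simp only [Finset.mem_filter, Finset.mem_univ, true_and, not_not] at this
          rw [h, this]
        · exact h
      obtain ⟨ψ, hψ, hψφ⟩ := ih (fun u hu => hA1 u (Finset.mem_insert_of_mem hu)) (by
        intro u hu x hx hf
        rcases Finset.mem_insert.1 (hA2 u (Finset.mem_insert_of_mem hu) x hx hf) with h | h
        · have := hcnt _ _ hf (by rw [h]; exact hmax u hu)
          rw [this]; exact hu
        · exact h)
      obtain ⟨p, hpP, hps⟩ := hA1 s (Finset.mem_insert_self _ _)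
      obtain ⟨U, g, oU, hg, hUg⟩ := hP p hpP
      let ε : ι → ℚ := fun i => ((s i : ℤ) : ℚ)
      have hsp : ∀ i, s i = SignType.sign (ℓ i p) := fun i => by rw [← hps]
      -- sign facts
      have f1 : ∀ i x, s i ≠ 0 → (0 < (ε i : ℝ) * ℓ i x ↔ sg x i = s i) := by
        intro i x hi
        simp only [ε, sg]
        rcases h : s i with _ | _ | _
        · exact absurd h hi
        · simp [sign_eq_neg_one_iff]
        · simp [sign_eq_one_iff]
      let C : Set (Pt r) := {x | (∀ i : {i // s i = 0}, ℓ i x = 0) ∧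
        ∀ j : {j // s j ≠ 0}, 0 ≤ (ε j : ℝ) * ℓ j x}
      have hCσ : ∀ x ∈ C, ∀ i, 0 ≤ ℓ i p → 0 ≤ ℓ i x := by
        intro x hx i hi
        by_cases hs0 : s i = 0
        · exact (hx.1 ⟨i, hs0⟩).ge
        · have h1 := hx.2 ⟨i, hs0⟩
          have h2 : s i = 1 := by
            rw [hsp] at hs0 ⊢
            rw [sign_eq_one_iff]
            exact lt_of_le_of_ne hi fun h => hs0 (by rw [← h]; simp)
          simpa [ε, h2] using h1
      have hCpoly : IsIntegralPolyhedron C := by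
        have := poly_of (f := Sum.elim (Sum.elim (fun i : {i // s i = 0} => ℓ i)
          (fun i : {i // s i = 0} => fun x => ((-1 : ℚ) : ℝ) * ℓ i x))
          (fun j : {j // s j ≠ 0} => fun x => (ε j : ℝ) * ℓ j x)) (by
            rintro ((i | i) | j)
            exacts [hℓ _, (hℓ _).smul _, (hℓ _).smul _])
        convert this using 1
        ext x
        constructor
        · rintro ⟨h1, h2⟩ ((i | i) | j)
          · simp [h1 i]
          · simp [h1 i]
          · exact h2 j
        · intro h
          refine ⟨fun i => le_antisymm ?_ (h (Sum.inl (Sum.inl i))), fun j => h (Sum.inr j)⟩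
          have := h (Sum.inl (Sum.inr i))
          simpa using this
      have hCface : ∀ x ∈ C, ∀ i, sg x i = 0 ∨ sg x i = s i := by
        intro x hx i
        by_cases hs0 : s i = 0
        · left
          have := hx.1 ⟨i, hs0⟩
          simp only at this
          simp [sg, this]
        · rcases (hx.2 ⟨i, hs0⟩).lt_or_eq with h | h
          · exact Or.inr ((f1 i x hs0).1 h)
          · left
            have he : (ε i : ℝ) ≠ 0 := by
              simp only [ε]
              rcases h : s i with _ | _ | _
              · exact absurd h hs0
              · simp
              · simp
            have := (mul_eq_zero.1 h.symm).resolve_left he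
            simp only at this
            simp [sg, this]
      obtain ⟨F, hF, hFC, hF0⟩ := key (fun i : {i // s i = 0} => ℓ i)
        (fun j : {j // s j ≠ 0} => fun x => (ε j : ℝ) * ℓ j x) (fun i => hℓ _)
        (fun j => (hℓ _).smul _) p
        (fun i => by
          have := i.2
          rw [hsp] at this
          exact sign_eq_zero_iff.1 this)
        (fun j => (f1 j p j.2).2 (by rw [hps])) C W hW rfl (fun x => φ x - ψ x)
        (by
          obtain ⟨n, σ, V, u, s1, s2, s3, s4, s5, s6⟩ := elimPS hψ
          refine mkPS (fun i => C ∩ σ i) (fun i => poly_inter hCpoly (s1 i)) (fun x => ?_)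
            (fun i => ⟨U ∩ V i, fun x => g x - u i x, oU.inter (s3 i), ?_, ?_, ?_⟩)
          · obtain ⟨i, hi⟩ := (s2 x).1 trivial
            exact ⟨fun hx => ⟨i, hx, hi⟩, fun ⟨_, hx⟩ => hx.1⟩
          · rintro x ⟨⟨hx1, hx2⟩, hx3⟩
            exact ⟨((hUg x (hCσ x hx1)).2 hx3).1, s4 i ⟨hx2, hx3⟩⟩
          · exact (hg.mono Set.inter_subset_left).sub ((s5 i).mono Set.inter_subset_right)
          · rintro x ⟨⟨hx1, hx2⟩, hx3⟩
            simp only [((hUg x (hCσ x hx1)).2 hx3).2, s6 i x ⟨hx2, hx3⟩])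
        (by
          rintro x ⟨hx1, hx2⟩ ⟨j, hj⟩
          have hxP := (hUg x (hCσ x hx1)).1
          rcases Finset.mem_insert.1 (hA2 s (Finset.mem_insert_self _ _) x hxP (hCface x hx1)) with h | h
          · exact absurd ((f1 j x j.2).2 (by rw [h])) (not_lt.2 hj)
          · rw [hψφ x ⟨hx2, hxP⟩ h, sub_self])
      refine ⟨fun x => ψ x + F x, PS_add hψ hF, ?_⟩
      rintro x ⟨hxW, hxP⟩ hx
      by_cases hxs : sg x = s
      · have hxC : x ∈ C := by
          refine ⟨fun i => ?_, fun j => ((f1 j x j.2).2 (by rw [hxs])).le⟩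
          have : sg x i.1 = 0 := (congrFun hxs i.1).trans i.2
          exact sign_eq_zero_iff.1 this
        simp only [hFC x ⟨hxC, hxW⟩]; ring
      · have hxA : sg x ∈ A := (Finset.mem_insert.1 hx).resolve_left hxs
        have : F x = 0 := by
          refine hF0 x hxW ?_
          by_contra hcon
          push Not at hcon
          refine hxs (hcnt s (sg x) (fun i => ?_) (hmax _ hxA)).symm
          by_cases hs0 : s i = 0
          · exact Or.inl hs0
          · exact Or.inr ((f1 i x hs0).1 (hcon ⟨i, hs0⟩)).symm
        simp only [this, add_zero]
        exact hψφ x ⟨hxW, hxP⟩ hxA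
  obtain ⟨ψ, hψ, h⟩ := main (Finset.univ.filter fun s => ∃ p ∈ P, sg p = s)
    (fun s hs => by simpa using hs) (fun s _ x hx _ => by simpa using ⟨x, hx, rfl⟩)
  exact ⟨ψ, hψ, fun x hx => h x hx (by simpa using ⟨x, hx.2, rfl⟩)⟩

/-- Proposition 1.8.  Let `φ` be a piecewise smooth function on an open subset `Ω` of an
integral ℝ-affine polyhedral set `P` in `N_ℝ = ℝ^r`, and let `Ω̃` be any open subset of
`N_ℝ` with `Ω̃ ∩ P = Ω`.  Then there is a piecewise smooth function on `Ω̃` (piecewise smooth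
with respect to the polyhedral set `N_ℝ` itself) which restricts to `φ` on `Ω`. -/
theorem extension_of_piecewise_smooth {r : ℕ} (P Ω Ωt : Set (Pt r)) (φ : Pt r → ℝ)
    (hP : IsPolyhedralSet P) (hΩt : IsOpen Ωt) (hΩ : Ωt ∩ P = Ω)
    (hφ : IsPiecewiseSmoothOn P Ω φ) :
    ∃ ψ : Pt r → ℝ, IsPiecewiseSmoothOn Set.univ Ωt ψ ∧ ∀ x ∈ Ω, ψ x = φ x := by
  subst hΩ
  obtain ⟨n, σ, U, g, h1, h2, h3, h4, h5, h6⟩ := elimPS hφ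
  choose m f hf hσ using fun i => poly_iff.1 (h1 i)
  obtain ⟨ψ, hψ, hψφ⟩ := main_aux (ι := Σ i : Fin n, Fin (m i)) P Ωt φ hΩt
    (fun k => f k.1 k.2) (fun k => hf _ _) (by
      intro p hp
      obtain ⟨i, hi⟩ := (h2 p).1 hp
      refine ⟨U i, g i, h3 i, h5 i, fun x hx => ?_⟩
      rw [hσ i] at hi
      have hxi : x ∈ σ i := by
        rw [hσ i]
        exact fun k => hx ⟨i, k⟩ (hi k)
      have hxP : x ∈ P := (h2 x).2 ⟨i, hxi⟩
      exact ⟨hxP, fun hW => ⟨h4 i ⟨hxi, hW, hxP⟩, h6 i x ⟨hxi, hW, hxP⟩⟩⟩)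
  exact ⟨ψ, hψ, hψφ⟩

end NonArchDelta
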